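/- Let A be a symmetric 3×3 real matrix, n a unit vector with nᵀAn = 1, and λ ∈ ℝ such that A − λI is invertible. Then nᵀ(A − λI)⁻¹n = 0 if and only if λ² + λ(1 − tr A) + nᵀ adj(A) n = 0, where adj(A) is the adjugate matrix of A. -/

import Mathlib

open Matrix

theorem adjugate_sub_smul_one_fin_three {R : Type*} [CommRing R]
    (A : Matrix (Fin 3) (Fin 3) R) (c : R) :
    (A - c • (1 : Matrix (Fin 3) (Fin 3) R)).adjugate =
      A.adjugate + c • A + (c ^ 2 - c * A.trace) • (1 : Matrix (Fin 3) (Fin 3) R) := by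
  ext i j
  fin_cases i <;> fin_cases j <;>
    simp [adjugate_fin_three, trace_fin_three] <;> ring

/-- nᵀ(A − λI)⁻¹n = 0 iff λ² + λ(1 − tr A) + nᵀ adj(A) n = 0, for symmetric A,
unit n with nᵀAn = 1, and A − λI invertible. -/
theorem inv_condition_iff_quadratic
    (A : Matrix (Fin 3) (Fin 3) ℝ) (hA : Aᵀ = A)
    (n : Fin 3 → ℝ) (hn : n ⬝ᵥ n = 1)
    (hAn : n ⬝ᵥ A.mulVec n = 1)
    (lam : ℝ) (hinv : IsUnit (A - lam • (1 : Matrix (Fin 3) (Fin 3) ℝ))) :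
    n ⬝ᵥ (A - lam • (1 : Matrix (Fin 3) (Fin 3) ℝ))⁻¹.mulVec n = 0 ↔
      lam ^ 2 + lam * (1 - A.trace) + n ⬝ᵥ A.adjugate.mulVec n = 0 := by
  have hdet := ((isUnit_iff_isUnit_det _).mp hinv).ne_zero
  have hquad : n ⬝ᵥ (A - lam • (1 : Matrix (Fin 3) (Fin 3) ℝ)).adjugate.mulVec n =
      lam ^ 2 + lam * (1 - A.trace) + n ⬝ᵥ A.adjugate.mulVec n := by
    simp only [adjugate_sub_smul_one_fin_three, add_mulVec, smul_mulVec, one_mulVec,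
      dotProduct_add, dotProduct_smul, hn, hAn, smul_eq_mul]
    ring
  rw [inv_def, Ring.inverse_eq_inv', smul_mulVec, dotProduct_smul, smul_eq_mul, hquad,
    mul_eq_zero, or_iff_right (inv_ne_zero hdet)]
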